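/- arXiv:2004.10953 — 2 statements merged into one kernel-verified Lean document; each statement's English description precedes it below -/
import Mathlib

section
/- Let m, n ≥ 1 and let D ⊆ ℚ^m × ℚ^n be a set definable with parameters in the first-order structure (ℚ, <) (a model of the theory of dense linear orders without endpoints). Then D is stable if and only if D is a finite union of sets of the form Z ∩ (X × Y), where Z ⊆ ℚ^m × ℚ^n is DLO-equational, X ⊆ ℚ^m is definable with parameters in (ℚ, <), and Y ⊆ ℚ^n is definable with parameters in (ℚ, <). -/
open Set FirstOrder

/-- A relation `D ⊆ S × T` is stable if there is no half-graph witness. -/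
def IsStable {S T : Type*} (D : Set (S × T)) : Prop :=
  ¬ ∃ (a : ℕ → S) (b : ℕ → T), ∀ i j : ℕ, (a i, b j) ∈ D ↔ i ≤ j

noncomputable instance : Language.order.Structure ℚ := Language.orderStructure ℚ

/-- DLO-equational subsets of ℚ^k. -/
inductive DLOEquational (k : ℕ) : Set (Fin k → ℚ) → Prop
  | eqCoord (i j : Fin k) : DLOEquational k {v | v i = v j}
  | eqConst (i : Fin k) (c : ℚ) : DLOEquational k {v | v i = c}
  | compl {s : Set (Fin k → ℚ)} : DLOEquational k s → DLOEquational k sᶜ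
  | union {s t : Set (Fin k → ℚ)} :
      DLOEquational k s → DLOEquational k t → DLOEquational k (s ∪ t)

/-- The identification of ℚ^{m+n} with ℚ^m × ℚ^n. -/
def joinQ (m n : ℕ) : (Fin (m + n) → ℚ) → (Fin m → ℚ) × (Fin n → ℚ) :=
  fun v => (fun i => v (Fin.castAdd n i), fun j => v (Fin.natAdd m j))

/-! ### Homogeneity of the rational order -/

theorem exists_orderIso_extending {ι : Type*} [Finite ι] (z z' : ι → ℚ)
    (h : ∀ i j, z i < z j ↔ z' i < z' j) : ∃ σ : ℚ ≃o ℚ, ∀ i, σ (z i) = z' i := by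
  classical
  have := Fintype.ofFinite ι
  have hcmp : ∀ i j, cmp (z i) (z j) = cmp (z' i) (z' j) := by
    intro i j
    simp only [cmp, cmpUsing, h]
  let p : Order.PartialIso ℚ ℚ := ⟨Finset.univ.image fun i => (z i, z' i), by
    simp only [Finset.mem_image, Finset.mem_univ, true_and]
    rintro _ ⟨i, rfl⟩ _ ⟨j, rfl⟩
    exact hcmp i j⟩
  let toCofinal : ℚ ⊕ ℚ → Order.Cofinal (Order.PartialIso ℚ ℚ) := fun p ↦
    Sum.recOn p (Order.PartialIso.definedAtLeft ℚ) (Order.PartialIso.definedAtRight ℚ)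
  let I : Order.Ideal (Order.PartialIso ℚ ℚ) := Order.idealOfCofinals p toCofinal
  let F a := Order.PartialIso.funOfIdeal a I
    (Order.cofinal_meets_idealOfCofinals _ toCofinal (Sum.inl a))
  let G b := Order.PartialIso.invOfIdeal b I
    (Order.cofinal_meets_idealOfCofinals _ toCofinal (Sum.inr b))
  refine ⟨OrderIso.ofCmpEqCmp (fun a ↦ (F a).val) (fun b ↦ (G b).val) fun a b ↦ ?_, fun i ↦ ?_⟩
  · rcases (F a).prop with ⟨f, hf, ha⟩
    rcases (G b).prop with ⟨g, hg, hb⟩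
    rcases I.directed _ hf _ hg with ⟨m, _, fm, gm⟩
    exact m.prop (a, _) (fm ha) (_, b) (gm hb)
  · rcases (F (z i)).prop with ⟨f, hf, ha⟩
    rcases I.directed _ hf _ (Order.mem_idealOfCofinals p toCofinal) with ⟨m, _, fm, gm⟩
    have hi : (z i, z' i) ∈ p.val := Finset.mem_image_of_mem _ (Finset.mem_univ i)
    have := m.prop (z i, _) (fm ha) (z i, z' i) (gm hi)
    simp only [cmp_self_eq_eq] at this
    exact (cmp_eq_eq_iff _ _).1 this.symm

/-! ### Sets supported by a finite set of parameters -/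

instance orderedStructure_rat : Language.order.OrderedStructure ℚ := ⟨fun _ => Iff.rfl⟩

/-- `D` is invariant under the order automorphisms of `ℚ` that fix `A` pointwise. -/
def IsSupportedBy {m n : ℕ} (A : Finset ℚ) (D : Set ((Fin m → ℚ) × (Fin n → ℚ))) : Prop :=
  ∀ σ : ℚ ≃o ℚ, (∀ a ∈ A, σ a = a) → ∀ x y, (x, y) ∈ D ↔ (σ ∘ x, σ ∘ y) ∈ D

theorem exists_isSupportedBy {m n : ℕ} {D : Set ((Fin m → ℚ) × (Fin n → ℚ))}
    (hD : Set.Definable (Set.univ : Set ℚ) Language.order (joinQ m n ⁻¹' D)) :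
    ∃ A, IsSupportedBy A D := by
  obtain ⟨A, -, hA⟩ := Set.definable_iff_finitely_definable.1 hD
  obtain ⟨φ, hφ⟩ := Set.definable_iff_exists_formula_sum.1 hA
  refine ⟨A, fun σ hσ x y => ?_⟩
  have key : ∀ x y, (x, y) ∈ D ↔ φ.Realize (Sum.elim (fun a : (A : Set ℚ) => (a : ℚ))
      (Fin.append x y)) := by
    intro x y
    have : (x, y) = joinQ m n (Fin.append x y) := by simp [joinQ]
    rw [this]
    exact Set.ext_iff.1 hφ (Fin.append x y)
  rw [key, key, ← Language.StrongHomClass.realize_formula (L := Language.order) σ]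
  refine iff_of_eq (congrArg _ (funext ?_))
  rintro (⟨a, ha⟩ | k)
  · exact hσ a ha
  · refine Fin.addCases (fun i => ?_) (fun j => ?_) k <;> simp

/-- A tuple of rationals extended by the parameters in `A`. -/
def withParams {ι : Type*} (A : Finset ℚ) (x : ι → ℚ) : ι ⊕ A → ℚ :=
  Sum.elim x Subtype.val

/-- The tuples `x` and `x'` have the same order type over `A`. -/
def SameOrderType {ι : Type*} (A : Finset ℚ) (x x' : ι → ℚ) : Prop :=
  ∀ i j, withParams A x i < withParams A x j ↔ withParams A x' i < withParams A x' j

theorem SameOrderType.symm {ι : Type*} {A : Finset ℚ} {x x' : ι → ℚ}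
    (h : SameOrderType A x x') : SameOrderType A x' x := fun i j => (h i j).symm

theorem SameOrderType.trans {ι : Type*} {A : Finset ℚ} {x x' x'' : ι → ℚ}
    (h : SameOrderType A x x') (h' : SameOrderType A x' x'') : SameOrderType A x x'' :=
  fun i j => (h i j).trans (h' i j)

theorem SameOrderType.exists_orderIso {ι : Type*} [Finite ι] {A : Finset ℚ} {x x' : ι → ℚ}
    (h : SameOrderType A x x') :
    ∃ σ : ℚ ≃o ℚ, (∀ a ∈ A, σ a = a) ∧ σ ∘ x = x' := by
  obtain ⟨σ, hσ⟩ := exists_orderIso_extending _ _ h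
  exact ⟨σ, fun a ha => hσ (Sum.inr ⟨a, ha⟩), funext fun i => hσ (Sum.inl i)⟩

theorem sameOrderType_comp {ι : Type*} {A : Finset ℚ} (σ : ℚ ≃o ℚ) (hσ : ∀ a ∈ A, σ a = a)
    (x : ι → ℚ) : SameOrderType A x (σ ∘ x) := by
  have key : ∀ i, withParams A (σ ∘ x) i = σ (withParams A x i) := by
    rintro (i | a)
    · rfl
    · exact (hσ a a.2).symm
  intro i j
  rw [key, key, σ.lt_iff_lt]

theorem SameOrderType.lt_iff {ι : Type*} {A : Finset ℚ} {x x' : ι → ℚ}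
    (h : SameOrderType A x x') (i j : ι) : x i < x j ↔ x' i < x' j :=
  h (Sum.inl i) (Sum.inl j)

theorem SameOrderType.lt_param_iff {ι : Type*} {A : Finset ℚ} {x x' : ι → ℚ}
    (h : SameOrderType A x x') (i : ι) {a : ℚ} (ha : a ∈ A) : x i < a ↔ x' i < a :=
  h (Sum.inl i) (Sum.inr ⟨a, ha⟩)

theorem SameOrderType.param_lt_iff {ι : Type*} {A : Finset ℚ} {x x' : ι → ℚ}
    (h : SameOrderType A x x') (i : ι) {a : ℚ} (ha : a ∈ A) : a < x i ↔ a < x' i :=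
  h (Sum.inr ⟨a, ha⟩) (Sum.inl i)

theorem IsSupportedBy.mem_iff {m n : ℕ} {A : Finset ℚ} {D : Set ((Fin m → ℚ) × (Fin n → ℚ))}
    (hD : IsSupportedBy A D) {x x' : Fin m → ℚ} {y y' : Fin n → ℚ}
    (h : SameOrderType A (Sum.elim x y) (Sum.elim x' y')) : (x, y) ∈ D ↔ (x', y') ∈ D := by
  obtain ⟨σ, hσ, hxy⟩ := h.exists_orderIso
  rw [Sum.comp_elim, Sum.elim_eq_iff] at hxy
  rw [hD σ hσ, hxy.1, hxy.2]

/-! ### Stable sets do not see the interleaving of their two arguments -/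

/-- Replace the value `u` in a tuple by `p`. -/
def substValue {ι : Type*} (u p : ℚ) (x : ι → ℚ) : ι → ℚ :=
  fun k => if x k = u then p else x k

theorem IsSupportedBy.mem_iff_of_adjacent {m n : ℕ} {A : Finset ℚ}
    {D : Set ((Fin m → ℚ) × (Fin n → ℚ))} (hD : IsSupportedBy A D) (hst : IsStable D)
    {x : Fin m → ℚ} {y : Fin n → ℚ} {l u v w r : ℚ} (hlu : l < u) (huv : u < v) (hvw : v < w)
    (hwr : w < r) (hx : ∀ i, x i ≤ l ∨ x i = u ∨ r ≤ x i) (hy : ∀ j, y j ≤ l ∨ y j = v ∨ r ≤ y j)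
    (hA : ∀ a ∈ A, a ≤ l ∨ r ≤ a) :
    (x, y) ∈ D ↔ (substValue u w x, y) ∈ D := by
  have key : ∀ p q p' q', l < p → p < r → l < q → q < r → l < p' → p' < r → l < q' → q' < r →
      (p < q ↔ p' < q') → (q < p ↔ q' < p') →
      ((substValue u p x, substValue v q y) ∈ D ↔
        (substValue u p' x, substValue v q' y) ∈ D) := by
    intro p q p' q' h1 h2 h3 h4 h5 h6 h7 h8 h9 h10
    apply hD.mem_iff
    rintro ((i | i) | ⟨i, hi⟩) ((j | j) | ⟨j, hj⟩) <;>
      simp only [withParams, Sum.elim_inl, Sum.elim_inr, substValue] <;> grind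
  have hxu : substValue u u x = x := by ext k; simp +contextual [substValue, eq_comm]
  have hyv : substValue v v y = y := by ext k; simp +contextual [substValue, eq_comm]
  have : Nontrivial (Set.Ioo l r) :=
    ⟨⟨u, by constructor <;> linarith⟩, ⟨v, by constructor <;> linarith⟩, fun h =>
      huv.ne (congrArg Subtype.val h)⟩
  obtain ⟨e⟩ := Order.embedding_from_countable_to_dense ℤ (Set.Ioo l r)
  have hel : ∀ t, l < (e t : ℚ) := fun t => (e t).2.1
  have her : ∀ t, (e t : ℚ) < r := fun t => (e t).2.2
  have helt : ∀ s t, (e s : ℚ) < e t ↔ s < t := fun s t => by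
    rw [Subtype.coe_lt_coe, e.lt_iff_lt]
  have hlt : ∀ s t : ℤ, s < t →
      ((substValue u (e s) x, substValue v (e t) y) ∈ D ↔ (x, y) ∈ D) := by
    intro s t hs
    have := key (e s) (e t) u v (hel _) (her _) (hel _) (her _) hlu (by linarith) (by linarith)
      (by linarith) (by rw [helt]; exact iff_of_true hs huv)
      (by rw [helt]; exact iff_of_false hs.not_gt huv.not_gt)
    rwa [hxu, hyv] at this
  have hgt : ∀ s t : ℤ, t < s →
      ((substValue u (e s) x, substValue v (e t) y) ∈ D ↔ (substValue u w x, y) ∈ D) := by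
    intro s t hs
    have := key (e s) (e t) w v (hel _) (her _) (hel _) (her _) (by linarith) hwr (by linarith)
      (by linarith) (by rw [helt]; exact iff_of_false hs.not_gt hvw.not_gt)
      (by rw [helt]; exact iff_of_true hs hvw)
    rwa [hyv] at this
  by_contra hne
  by_cases hxy : (x, y) ∈ D
  · refine hst ⟨fun i => substValue u (e (2 * i)) x, fun j => substValue v (e (2 * j + 1)) y,
      fun i j => ?_⟩
    rcases le_or_gt i j with hij | hij
    · rw [hlt _ _ (by omega)]; tauto
    · rw [hgt _ _ (by omega)]; simp only [hij.not_ge]; tauto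
  · refine hst ⟨fun i => substValue u (e (-2 * i)) x, fun j => substValue v (e (-2 * j - 1)) y,
      fun i j => ?_⟩
    rcases le_or_gt i j with hij | hij
    · rw [hgt _ _ (by omega)]; tauto
    · rw [hlt _ _ (by omega)]; simp only [hij.not_ge]; tauto

/-- The pairs `(i, j)` such that `y j` lies strictly between `x i` and `x' i`. -/
def separatedPairs {m n : ℕ} (y : Fin n → ℚ) (x x' : Fin m → ℚ) : Finset (Fin m × Fin n) :=
  {p | (x p.1 < y p.2 ∧ y p.2 < x' p.1) ∨ (x' p.1 < y p.2 ∧ y p.2 < x p.1)}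

theorem separatedPairs_comm {m n : ℕ} (y : Fin n → ℚ) (x x' : Fin m → ℚ) :
    separatedPairs y x x' = separatedPairs y x' x := by
  ext p
  simp only [separatedPairs, Finset.mem_filter, or_comm]

/-- Moving one value of `x` upwards, across a single value of `y`, towards `x'`. -/
theorem exists_separatedPairs_ssubset {m n : ℕ} {A : Finset ℚ}
    {D : Set ((Fin m → ℚ) × (Fin n → ℚ))} (hD : IsSupportedBy A D) (hst : IsStable D)
    {x x' : Fin m → ℚ} {y : Fin n → ℚ} (h : SameOrderType A x x')
    (he : ∀ i j, x i = y j ↔ x' i = y j) (hex : ∃ i j, x i < y j ∧ y j < x' i) :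
    ∃ x₁, SameOrderType A x₁ x' ∧ (∀ i j, x₁ i = y j ↔ x' i = y j) ∧
      separatedPairs y x₁ x' ⊂ separatedPairs y x x' ∧ ((x, y) ∈ D ↔ (x₁, y) ∈ D) := by
  classical
  obtain ⟨i, hi, himax⟩ := Finset.exists_max_image
    (Finset.univ.filter fun i => ∃ j, x i < y j ∧ y j < x' i) x
    (by obtain ⟨i, hi⟩ := hex; exact ⟨i, by simpa using hi⟩)
  simp only [Finset.mem_filter, Finset.mem_univ, true_and, forall_exists_index] at hi himax
  obtain ⟨j, hj, hjmin⟩ := Finset.exists_min_image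
    (Finset.univ.filter fun j => x i < y j ∧ y j < x' i) y
    (by obtain ⟨j, hj⟩ := hi; exact ⟨j, by simpa using hj⟩)
  simp only [Finset.mem_filter, Finset.mem_univ, true_and] at hj hjmin
  let S : Finset ℚ := Finset.univ.image x ∪ Finset.univ.image y ∪ A
  have hSx : ∀ k, x k ∈ S := fun k => by simp [S]
  have hSy : ∀ k, y k ∈ S := fun k => by simp [S]
  have hSA : ∀ a ∈ A, a ∈ S := fun a ha => by simp [S, ha]
  obtain ⟨l, hl, hlu⟩ := Order.exists_between_finsets (S.filter (· < x i)) {x i} (by simp)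
  obtain ⟨r, hvr, hr⟩ := Order.exists_between_finsets {y j} (S.filter (y j < ·)) (by simp)
  simp only [Finset.mem_filter, Finset.mem_singleton, forall_eq, and_imp] at hl hlu hvr hr
  obtain ⟨w, hvw, hwr⟩ := exists_between hvr
  have hx : ∀ k, x k ≤ l ∨ x k = x i ∨ r ≤ x k := by
    intro k
    have h1 := hl _ (hSx k)
    have h2 := hr _ (hSx k)
    have h3 := himax k j
    have h4 := h.lt_iff i k
    have h5 := he k j
    grind
  have hy : ∀ k, y k ≤ l ∨ y k = y j ∨ r ≤ y k := by
    intro k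
    have h1 := hl _ (hSy k)
    have h2 := hr _ (hSy k)
    have h3 := hjmin k
    have h4 := he i k
    grind
  have hA : ∀ a ∈ A, a ≤ l ∨ r ≤ a := by
    intro a ha
    have h1 := hl _ (hSA a ha)
    have h2 := hr _ (hSA a ha)
    have h4 := h.lt_param_iff i ha
    have h5 := h.param_lt_iff i ha
    grind
  have hx' : ∀ k, x k = x i → x' k = x' i := by
    intro k hk
    have h1 := h.lt_iff i k
    have h2 := h.lt_iff k i
    grind
  refine ⟨substValue (x i) w x, SameOrderType.trans (SameOrderType.symm ?_) h, ?_, ?_,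
    hD.mem_iff_of_adjacent hst hlu hj.1 hvw hwr hx hy hA⟩
  · rintro (k | ⟨k, hk⟩) (k' | ⟨k', hk'⟩) <;>
      simp only [withParams, Sum.elim_inl, Sum.elim_inr, substValue] <;> grind
  · intro k k'
    rw [← he]
    have h1 := hy k'
    simp only [substValue]
    grind
  · rw [Finset.ssubset_iff_of_subset]
    · refine ⟨(i, j), by simp [separatedPairs, hj], ?_⟩
      simp only [separatedPairs, substValue]
      grind
    · rintro ⟨k, k'⟩
      have h1 := hx' k
      have h2 := hy k'
      simp only [separatedPairs, substValue, Finset.mem_filter, Finset.mem_univ, true_and]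
      grind

theorem IsSupportedBy.mem_iff_left {m n : ℕ} {A : Finset ℚ}
    {D : Set ((Fin m → ℚ) × (Fin n → ℚ))} (hD : IsSupportedBy A D) (hst : IsStable D)
    {x x' : Fin m → ℚ} {y : Fin n → ℚ} (h : SameOrderType A x x')
    (he : ∀ i j, x i = y j ↔ x' i = y j) : (x, y) ∈ D ↔ (x', y) ∈ D := by
  induction hs : separatedPairs y x x' using Finset.strongInduction generalizing x x' with
  | H s ih =>
    subst hs
    by_cases h1 : ∃ i j, x i < y j ∧ y j < x' i
    · obtain ⟨x₁, ht, he₁, hss, hiff⟩ := exists_separatedPairs_ssubset hD hst h he h1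
      rw [hiff, ih _ hss ht he₁ rfl]
    by_cases h2 : ∃ i j, x' i < y j ∧ y j < x i
    · obtain ⟨x₁, ht, he₁, hss, hiff⟩ :=
        exists_separatedPairs_ssubset hD hst h.symm (fun i j => (he i j).symm) h2
      rw [separatedPairs_comm y x' x] at hss
      rw [hiff, ih _ hss ht he₁ rfl]
    push Not at h1 h2
    apply hD.mem_iff
    have hlt : ∀ i j, x i < y j ↔ x' i < y j := fun i j => by
      have := h1 i j; have := h2 i j; have := he i j; grind
    have hgt : ∀ i j, y j < x i ↔ y j < x' i := fun i j => by
      have := h1 i j; have := h2 i j; have := he i j; grind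
    rintro ((i | i) | ⟨i, hi⟩) ((j | j) | ⟨j, hj⟩)
    · exact h.lt_iff i j
    · exact hlt i j
    · exact h.lt_param_iff i hj
    · exact hgt j i
    · exact Iff.rfl
    · exact Iff.rfl
    · exact h.param_lt_iff j hi
    · exact Iff.rfl
    · exact Iff.rfl

/-- Membership in a stable set supported by `A` depends only on the order types over `A` of the two
arguments and on the equalities between their coordinates. -/
theorem IsSupportedBy.mem_iff_of_isStable {m n : ℕ} {A : Finset ℚ}
    {D : Set ((Fin m → ℚ) × (Fin n → ℚ))} (hD : IsSupportedBy A D) (hst : IsStable D)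
    {x x' : Fin m → ℚ} {y y' : Fin n → ℚ} (hx : SameOrderType A x x') (hy : SameOrderType A y y')
    (he : ∀ i j, x i = y j ↔ x' i = y' j) : (x, y) ∈ D ↔ (x', y') ∈ D := by
  obtain ⟨σ, hσ, rfl⟩ := hy.exists_orderIso
  rw [hD σ hσ x y]
  refine hD.mem_iff_left hst ((sameOrderType_comp σ hσ x).symm.trans hx) fun i j => ?_
  rw [← he]
  exact σ.injective.eq_iff

/-! ### Double limits -/

/-- Iterated ultrafilter limits of membership in `D` can be interchanged. -/
def HasDoubleLimits {S T : Type*} (D : Set (S × T)) : Prop :=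
  ∀ (a : ℕ → S) (b : ℕ → T),
    (∀ᶠ i in Filter.hyperfilter ℕ, ∀ᶠ j in Filter.hyperfilter ℕ, (a i, b j) ∈ D) ↔
      ∀ᶠ j in Filter.hyperfilter ℕ, ∀ᶠ i in Filter.hyperfilter ℕ, (a i, b j) ∈ D

namespace HasDoubleLimits

variable {S T : Type*} {D E : Set (S × T)}

theorem compl (hD : HasDoubleLimits D) : HasDoubleLimits Dᶜ := by
  intro a b
  simpa only [Set.mem_compl_iff, Ultrafilter.eventually_not] using not_congr (hD a b)

theorem union (hD : HasDoubleLimits D) (hE : HasDoubleLimits E) : HasDoubleLimits (D ∪ E) := by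
  intro a b
  simpa only [Set.mem_union, Ultrafilter.eventually_or] using or_congr (hD a b) (hE a b)

theorem inter (hD : HasDoubleLimits D) (hE : HasDoubleLimits E) : HasDoubleLimits (D ∩ E) := by
  intro a b
  simpa only [Set.mem_inter_iff, Filter.eventually_and] using and_congr (hD a b) (hE a b)

theorem of_left (X : Set S) : HasDoubleLimits {p : S × T | p.1 ∈ X} := by
  intro a b
  simp

theorem of_right (Y : Set T) : HasDoubleLimits {p : S × T | p.2 ∈ Y} := by
  intro a b
  simp

theorem prod (X : Set S) (Y : Set T) : HasDoubleLimits (X ×ˢ Y) :=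
  (of_left X).inter (of_right Y)

theorem iUnion {ι : Type*} [Finite ι] {D : ι → Set (S × T)} (hD : ∀ i, HasDoubleLimits (D i)) :
    HasDoubleLimits (⋃ i, D i) := by
  rw [← Set.biUnion_univ]
  refine Set.Finite.induction_on _ Set.finite_univ ?_ ?_
  · intro a b
    simp
  · intro i s _ _ hs
    rw [Set.biUnion_insert]
    exact (hD i).union hs

theorem eq_of_fun {R : Type*} (f : S → R) (g : T → R) :
    HasDoubleLimits {p : S × T | f p.1 = g p.2} := by
  intro a b
  constructor
  · intro h
    obtain ⟨i, hi⟩ := h.exists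
    filter_upwards [hi] with j hj
    filter_upwards [h] with i' hi'
    obtain ⟨j', h1, h2⟩ := (hi.and hi').exists
    exact h2.trans (h1.symm.trans hj)
  · intro h
    obtain ⟨j, hj⟩ := h.exists
    filter_upwards [hj] with i hi
    filter_upwards [h] with j' hj'
    obtain ⟨i', h1, h2⟩ := (hj.and hj').exists
    exact hi.trans (h1.symm.trans h2)

theorem isStable (hD : HasDoubleLimits D) : IsStable D := by
  rintro ⟨a, b, hab⟩
  have hcof : (Filter.hyperfilter ℕ : Filter ℕ) ≤ (Filter.atTop : Filter ℕ) :=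
    Nat.cofinite_eq_atTop ▸ Filter.hyperfilter_le_cofinite
  have h1 := (hD a b).1 (.of_forall fun i =>
    hcof ((Filter.eventually_ge_atTop i).mono fun j hj => (hab i j).2 hj))
  obtain ⟨j, hj⟩ := h1.exists
  obtain ⟨i, hi, hij⟩ := (hj.and (hcof (Filter.eventually_gt_atTop j))).exists
  exact hij.not_ge ((hab i j).1 hi)

end HasDoubleLimits

theorem DLOEquational.hasDoubleLimits {m n : ℕ} {Z : Set ((Fin m → ℚ) × (Fin n → ℚ))}
    (hZ : DLOEquational (m + n) (joinQ m n ⁻¹' Z)) : HasDoubleLimits Z := by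
  have key : ∀ s, DLOEquational (m + n) s →
      HasDoubleLimits {p : (Fin m → ℚ) × (Fin n → ℚ) | Fin.append p.1 p.2 ∈ s} := by
    intro s hs
    induction hs with
    | eqCoord i j =>
      refine Fin.addCases (fun i => ?_) (fun i => ?_) i <;>
        refine Fin.addCases (fun j => ?_) (fun j => ?_) j <;>
        simp only [Set.mem_ofPred_eq, Fin.append_left, Fin.append_right]
      · simpa using HasDoubleLimits.of_left {x : Fin m → ℚ | x i = x j}
      · exact .eq_of_fun (fun x : Fin m → ℚ => x i) fun y : Fin n → ℚ => y j
      · simp only [eq_comm (a := (_ : (Fin m → ℚ) × (Fin n → ℚ)).2 i)]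
        exact .eq_of_fun (fun x : Fin m → ℚ => x j) fun y : Fin n → ℚ => y i
      · simpa using HasDoubleLimits.of_right {y : Fin n → ℚ | y i = y j}
    | eqConst i c =>
      refine Fin.addCases (fun i => ?_) (fun i => ?_) i <;>
        simp only [Set.mem_ofPred_eq, Fin.append_left, Fin.append_right]
      · simpa using HasDoubleLimits.of_left {x : Fin m → ℚ | x i = c}
      · simpa using HasDoubleLimits.of_right {y : Fin n → ℚ | y i = c}
    | compl _ ih => exact ih.compl
    | union _ _ ih₁ ih₂ => exact ih₁.union ih₂
  convert key _ hZ using 1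
  ext ⟨x, y⟩
  simp [joinQ]

/-! ### Definability of the pieces of the decomposition -/

theorem DLOEquational.inter {k : ℕ} {s t : Set (Fin k → ℚ)} (hs : DLOEquational k s)
    (ht : DLOEquational k t) : DLOEquational k (s ∩ t) := by
  rw [← compl_compl (s ∩ t), Set.compl_inter]
  exact (hs.compl.union ht.compl).compl

theorem DLOEquational.univ {k : ℕ} [NeZero k] : DLOEquational k Set.univ := by
  simpa using DLOEquational.eqCoord (0 : Fin k) 0

theorem DLOEquational.iInter {k : ℕ} [NeZero k] {ι : Type*} [Finite ι] {s : ι → Set (Fin k → ℚ)}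
    (hs : ∀ i, DLOEquational k (s i)) : DLOEquational k (⋂ i, s i) := by
  rw [← Set.biInter_univ]
  refine Set.Finite.induction_on _ Set.finite_univ ?_ ?_
  · simpa using DLOEquational.univ
  · intro i t _ _ ht
    rw [Set.biInter_insert]
    exact (hs i).inter ht

theorem definable_withParams_lt {m : ℕ} (A : Finset ℚ) (k k' : Fin m ⊕ A) :
    Set.Definable (Set.univ : Set ℚ) Language.order
      {x : Fin m → ℚ | withParams A x k < withParams A x k'} := by
  rw [Set.definable_iff_exists_formula_sum]
  let v : Fin m ⊕ A → Language.order.Term (((Set.univ : Set ℚ) ⊕ Fin m) ⊕ Fin 0) :=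
    Sum.elim (fun i => .var (.inl (.inr i))) fun a => .var (.inl (.inl ⟨a, trivial⟩))
  have hv : ∀ k (x : Fin m → ℚ) (w : Fin 0 → ℚ),
      (v k).realize (Sum.elim (Sum.elim (Subtype.val : ↥(Set.univ : Set ℚ) → ℚ) x) w) =
        withParams A x k := by
    rintro (i | a) x w <;> rfl
  refine ⟨(v k).lt (v k'), ?_⟩
  ext x
  simp only [Set.mem_ofPred_eq, Language.Formula.Realize, Language.Term.realize_lt, hv]

theorem definable_sameOrderType {m : ℕ} (A : Finset ℚ) (x₀ : Fin m → ℚ) :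
    Set.Definable (Set.univ : Set ℚ) Language.order {x | SameOrderType A x₀ x} := by
  have : {x | SameOrderType A x₀ x} =
      ⋂ (k) (k'), {x | withParams A x₀ k < withParams A x₀ k' ↔
        withParams A x k < withParams A x k'} := by
    ext x
    simp [SameOrderType]
  rw [this]
  refine Set.definable_iInter_of_finite fun k => Set.definable_iInter_of_finite fun k' => ?_
  by_cases h : withParams A x₀ k < withParams A x₀ k'
  · simpa only [h, true_iff] using definable_withParams_lt A k k'
  · simpa only [h, false_iff, Set.compl_ofPred] using (definable_withParams_lt A k k').compl

theorem dloEquational_eq_pattern {m n : ℕ} [NeZero (m + n)] (e : Fin m → Fin n → Prop) :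
    DLOEquational (m + n) (joinQ m n ⁻¹' {p | ∀ i j, e i j ↔ p.1 i = p.2 j}) := by
  have : joinQ m n ⁻¹' {p | ∀ i j, e i j ↔ p.1 i = p.2 j} =
      ⋂ (i) (j), {v | e i j ↔ v (Fin.castAdd n i) = v (Fin.natAdd m j)} := by
    ext v
    simp [joinQ]
  rw [this]
  refine DLOEquational.iInter fun i => DLOEquational.iInter fun j => ?_
  by_cases h : e i j
  · simpa only [h, true_iff] using DLOEquational.eqCoord (Fin.castAdd n i) (Fin.natAdd m j)
  · simpa only [h, false_iff, Set.compl_ofPred] using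
      (DLOEquational.eqCoord (Fin.castAdd n i) (Fin.natAdd m j)).compl

/-- The relations determining membership of a pair in a stable set supported by `A`. -/
def pairType {m n : ℕ} (A : Finset ℚ) (p : (Fin m → ℚ) × (Fin n → ℚ)) :
    (Fin m ⊕ A → Fin m ⊕ A → Prop) × (Fin n ⊕ A → Fin n ⊕ A → Prop) ×
      (Fin m → Fin n → Prop) :=
  (fun k k' => withParams A p.1 k < withParams A p.1 k',
    fun k k' => withParams A p.2 k < withParams A p.2 k', fun i j => p.1 i = p.2 j)

theorem pairType_eq_iff {m n : ℕ} {A : Finset ℚ} {p q : (Fin m → ℚ) × (Fin n → ℚ)} :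
    pairType A p = pairType A q ↔ SameOrderType A p.1 q.1 ∧ SameOrderType A p.2 q.2 ∧
      ∀ i j, p.1 i = p.2 j ↔ q.1 i = q.2 j := by
  simp [pairType, SameOrderType, funext_iff]

theorem stmt0 (m n : ℕ) (hm : 1 ≤ m) (hn : 1 ≤ n)
    (D : Set ((Fin m → ℚ) × (Fin n → ℚ)))
    (hD : Set.Definable (Set.univ : Set ℚ) Language.order (joinQ m n ⁻¹' D)) :
    IsStable D ↔
      ∃ (k : ℕ) (Z : Fin k → Set ((Fin m → ℚ) × (Fin n → ℚ)))
        (X : Fin k → Set (Fin m → ℚ)) (Y : Fin k → Set (Fin n → ℚ)),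
        (∀ i, DLOEquational (m + n) (joinQ m n ⁻¹' Z i)) ∧
        (∀ i, Set.Definable (Set.univ : Set ℚ) Language.order (X i)) ∧
        (∀ i, Set.Definable (Set.univ : Set ℚ) Language.order (Y i)) ∧
        D = ⋃ i, Z i ∩ (X i) ×ˢ (Y i) := by
  constructor
  · intro hst
    obtain ⟨A, hA⟩ := exists_isSupportedBy hD
    have : NeZero (m + n) := ⟨by omega⟩
    obtain ⟨k, ⟨f⟩⟩ := Finite.exists_equiv_fin (pairType A '' D)
    choose p hpD hp using fun i => (f.symm i).2
    refine ⟨k, fun i => {q | ∀ s t, (p i).1 s = (p i).2 t ↔ q.1 s = q.2 t},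
      fun i => {x | SameOrderType A (p i).1 x}, fun i => {y | SameOrderType A (p i).2 y},
      fun i => dloEquational_eq_pattern _, fun i => definable_sameOrderType A _,
      fun i => definable_sameOrderType A _, ?_⟩
    ext q
    simp only [Set.mem_iUnion, Set.mem_inter_iff, Set.mem_ofPred_eq, Set.mem_prod]
    constructor
    · intro hq
      refine ⟨f ⟨_, q, hq, rfl⟩, ?_⟩
      have := hp (f ⟨_, q, hq, rfl⟩)
      rw [f.symm_apply_apply, pairType_eq_iff] at this
      exact ⟨this.2.2, this.1, this.2.1⟩
    · rintro ⟨i, he, hx, hy⟩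
      exact (hA.mem_iff_of_isStable hst hx hy he).1 (hpD i)
  · rintro ⟨k, Z, X, Y, hZ, -, -, rfl⟩
    exact (HasDoubleLimits.iUnion fun i => (hZ i).hasDoubleLimits.inter (.prod _ _)).isStable
end

section
/- Let m, n ≥ 1 and let D ⊆ ℚ^m × ℚ^n be a set definable with parameters in the first-order structure (ℚ, +, <) (a model of the theory of divisible ordered abelian groups). Then D is stable if and only if D is a finite union of sets of the form Z ∩ (X × Y), where Z ⊆ ℚ^m × ℚ^n is DOAG-equational, X ⊆ ℚ^m is definable with parameters in (ℚ, +, <), and Y ⊆ ℚ^n is definable with parameters in (ℚ, +, <). -/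
open Set FirstOrder

/-- The language of ordered groups: one binary function symbol `+`
and one binary relation symbol `<`. -/
def DOAGLang : Language where
  Functions := fun n => match n with | 2 => Unit | _ => Empty
  Relations := fun n => match n with | 2 => Unit | _ => Empty

/-- The structure `(ℚ, +, <)`. -/
instance : DOAGLang.Structure ℚ where
  funMap := fun {n} f x =>
    match n, f with
    | 2, _ => x 0 + x 1
  RelMap := fun {n} r x =>
    match n, r with
    | 2, _ => x 0 < x 1

/-- DOAG-equational subsets of ℚ^k : Boolean combinations of solution sets of
`k₁ v₁ + ⋯ + k_k v_k = c` with integer coefficients. -/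
inductive DOAGEquational (k : ℕ) : Set (Fin k → ℚ) → Prop
  | linear (a : Fin k → ℤ) (c : ℚ) :
      DOAGEquational k {v | ∑ i, (a i : ℚ) * v i = c}
  | compl {s : Set (Fin k → ℚ)} : DOAGEquational k s → DOAGEquational k sᶜ
  | union {s t : Set (Fin k → ℚ)} :
      DOAGEquational k s → DOAGEquational k t → DOAGEquational k (s ∪ t)

/-! ### Ladders and the infinite Ramsey theorem for pairs -/

theorem exists_homogeneous_seq_of_eventually {U : Ultrafilter ℕ} (hU : (U : Filter ℕ) ≤ Filter.atTop)
    {P : ℕ → ℕ → Prop} (h : ∀ᶠ i in (U : Filter ℕ), ∀ᶠ j in (U : Filter ℕ), P i j) :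
    ∃ g : ℕ → ℕ, ∀ i j, i < j → g i < g j ∧ P (g i) (g j) := by
  obtain ⟨g, -, hg⟩ := exists_seq_of_forall_finset_exists
    (fun i => ∀ᶠ j in (U : Filter ℕ), P i j) (fun i j => i < j ∧ P i j) (fun s hs => by
      have h1 : ∀ᶠ j in (U : Filter ℕ), ∀ x ∈ s, x < j ∧ P x j :=
        (Filter.eventually_all_finset s).2 fun x hx =>
          ((Filter.eventually_gt_atTop x).filter_mono hU).and (hs x hx)
      exact (h.and h1).exists)
  exact ⟨g, hg⟩

theorem exists_homogeneous_seq (P : ℕ → ℕ → Prop) :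
    ∃ g : ℕ → ℕ, (∀ i j, i < j → g i < g j) ∧
      ((∀ i j, i < j → P (g i) (g j)) ∨ ∀ i j, i < j → ¬ P (g i) (g j)) := by
  have hU : (Filter.hyperfilter ℕ : Filter ℕ) ≤ Filter.atTop :=
    Filter.hyperfilter_le_cofinite.trans_eq Nat.cofinite_eq_atTop
  by_cases h : ∀ᶠ i in (Filter.hyperfilter ℕ : Filter ℕ),
      ∀ᶠ j in (Filter.hyperfilter ℕ : Filter ℕ), P i j
  · obtain ⟨g, hg⟩ := exists_homogeneous_seq_of_eventually hU h
    exact ⟨g, fun i j hij => (hg i j hij).1, Or.inl fun i j hij => (hg i j hij).2⟩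
  · rw [← Ultrafilter.eventually_not] at h
    simp only [← Ultrafilter.eventually_not] at h
    obtain ⟨g, hg⟩ := exists_homogeneous_seq_of_eventually hU h
    exact ⟨g, fun i j hij => (hg i j hij).1, Or.inr fun i j hij => (hg i j hij).2⟩

/-- A pair of sequences witnessing the order property for `D`, off the diagonal. -/
def IsLadder {S T : Type*} (D : Set (S × T)) (a : ℕ → S) (b : ℕ → T) : Prop :=
  ∀ i j, i < j → (a i, b j) ∈ D ∧ (a j, b i) ∉ D

/-- Neither `D` nor its complement has a ladder. -/
def LadderFree {S T : Type*} (D : Set (S × T)) : Prop :=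
  (∀ a b, ¬ IsLadder D a b) ∧ ∀ a b, ¬ IsLadder Dᶜ a b

namespace LadderFree

variable {S T : Type*} {D E : Set (S × T)}

theorem compl (h : LadderFree D) : LadderFree Dᶜ :=
  ⟨h.2, by simpa only [compl_compl] using h.1⟩

theorem union (hD : LadderFree D) (hE : LadderFree E) : LadderFree (D ∪ E) := by
  constructor
  · intro a b h
    obtain ⟨g, hg, h1 | h1⟩ := exists_homogeneous_seq fun i j => (a i, b j) ∈ D
    · exact hD.1 (a ∘ g) (b ∘ g) fun i j hij =>
        ⟨h1 i j hij, fun h2 => (h _ _ (hg i j hij)).2 (Or.inl h2)⟩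
    · exact hE.1 (a ∘ g) (b ∘ g) fun i j hij =>
        ⟨(h _ _ (hg i j hij)).1.resolve_left (h1 i j hij),
          fun h2 => (h _ _ (hg i j hij)).2 (Or.inr h2)⟩
  · intro a b h
    obtain ⟨g, hg, h1 | h1⟩ := exists_homogeneous_seq fun i j => (a j, b i) ∈ D
    · exact hD.2 (a ∘ g) (b ∘ g) fun i j hij =>
        ⟨fun h2 => (h _ _ (hg i j hij)).1 (Or.inl h2), not_not.2 (h1 i j hij)⟩
    · exact hE.2 (a ∘ g) (b ∘ g) fun i j hij =>
        ⟨fun h2 => (h _ _ (hg i j hij)).1 (Or.inr h2), not_not.2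
          ((not_not.1 (h _ _ (hg i j hij)).2).resolve_left (h1 i j hij))⟩

theorem inter (hD : LadderFree D) (hE : LadderFree E) : LadderFree (D ∩ E) := by
  simpa [Set.compl_union] using (hD.compl.union hE.compl).compl

theorem empty : LadderFree (∅ : Set (S × T)) :=
  ⟨fun _ _ h => (h 0 1 one_pos).1, fun _ _ h => (h 0 1 one_pos).2 id⟩

theorem iUnion {ι : Type*} [Finite ι] {D : ι → Set (S × T)} (h : ∀ i, LadderFree (D i)) :
    LadderFree (⋃ i, D i) := by
  classical
  have := Fintype.ofFinite ι
  suffices ∀ s : Finset ι, LadderFree (⋃ i ∈ s, D i) by simpa using this Finset.univ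
  intro s
  induction s using Finset.induction_on with
  | empty => simpa using empty
  | insert i s _ ih => simpa using (h i).union ih

theorem prod (X : Set S) (Y : Set T) : LadderFree (X ×ˢ Y) := by
  constructor
  · intro a b h
    exact (h 1 2 (by simp)).2 ⟨(h 2 3 (by simp)).1.1, (h 0 1 (by simp)).1.2⟩
  · intro a b h
    exact (h 1 2 (by simp)).1
      ⟨(not_not.1 (h 0 1 (by simp)).2).1, (not_not.1 (h 2 3 (by simp)).2).2⟩

theorem setOf_add_eq {M : Type*} [AddGroup M] (f : S → M) (g : T → M) (c : M) :
    LadderFree {p : S × T | f p.1 + g p.2 = c} := by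
  constructor
  · intro a b h
    have h01 : f (a 0) + g (b 1) = c := (h 0 1 (by simp)).1
    have h03 : f (a 0) + g (b 3) = c := (h 0 3 (by simp)).1
    have h23 : f (a 2) + g (b 3) = c := (h 2 3 (by simp)).1
    refine (h 1 2 (by simp)).2 (show f (a 2) + g (b 1) = c from ?_)
    rw [add_right_cancel (h23.trans h03.symm), h01]
  · intro a b h
    have h10 : f (a 1) + g (b 0) = c := not_not.1 (h 0 1 (by simp)).2
    have h30 : f (a 3) + g (b 0) = c := not_not.1 (h 0 3 (by simp)).2
    have h32 : f (a 3) + g (b 2) = c := not_not.1 (h 2 3 (by simp)).2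
    refine (h 1 2 (by simp)).1 (show f (a 1) + g (b 2) = c from ?_)
    rw [add_right_cancel (h10.trans h30.symm), h32]

theorem isStable (h : LadderFree D) : IsStable D := by
  rintro ⟨a, b, hab⟩
  exact h.1 a b fun i j hij => ⟨(hab i j).2 hij.le, fun h' => hij.not_ge ((hab j i).1 h')⟩

end LadderFree

theorem joinQ_append {m n : ℕ} (x : Fin m → ℚ) (y : Fin n → ℚ) :
    joinQ m n (Fin.append x y) = (x, y) := by
  simp [joinQ]

theorem DOAGEquational.ladderFree {m n : ℕ} {s : Set (Fin (m + n) → ℚ)}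
    (hs : DOAGEquational (m + n) s) :
    LadderFree {p : (Fin m → ℚ) × (Fin n → ℚ) | Fin.append p.1 p.2 ∈ s} := by
  induction hs with
  | linear a c =>
    simpa [Fin.sum_univ_add] using LadderFree.setOf_add_eq
      (fun x : Fin m → ℚ => ∑ i, (a (Fin.castAdd n i) : ℚ) * x i)
      (fun y : Fin n → ℚ => ∑ i, (a (Fin.natAdd m i) : ℚ) * y i) c
  | compl _ ih => exact ih.compl
  | union _ _ ih₁ ih₂ => exact ih₁.union ih₂

/-! ### Semilinear sets and quantifier elimination -/

theorem exists_sign_sub_eq {ι K : Type*} [Finite ι] [Field K] [LinearOrder K] [IsStrictOrderedRing K]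
    {f g : ι → K} (h : ∀ i j, SignType.sign (f i - f j) = SignType.sign (g i - g j)) (x : K) :
    ∃ y, ∀ i, SignType.sign (x - f i) = SignType.sign (y - g i) := by
  have := Fintype.ofFinite ι
  by_cases hx : ∃ j, x = f j
  · obtain ⟨j, rfl⟩ := hx
    exact ⟨g j, h j⟩
  · push Not at hx
    obtain ⟨y, hy₁, hy₂⟩ := Order.exists_between_finsets
      (lo := (Finset.univ.filter fun i => f i < x).image g)
      (hi := (Finset.univ.filter fun i => x < f i).image g) (by
        simp only [Finset.mem_image, Finset.mem_filter, Finset.mem_univ, true_and]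
        rintro _ ⟨i, hi, rfl⟩ _ ⟨j, hj, rfl⟩
        have hij := h j i
        rw [sign_pos (sub_pos.2 (hi.trans hj))] at hij
        exact sub_pos.1 (sign_eq_one_iff.1 hij.symm))
    simp only [Finset.mem_image, Finset.mem_filter, Finset.mem_univ, true_and,
      forall_exists_index, and_imp, forall_apply_eq_imp_iff₂] at hy₁ hy₂
    refine ⟨y, fun i => ?_⟩
    rcases lt_or_gt_of_ne (hx i) with hi | hi
    · rw [sign_neg (sub_neg.2 hi), sign_neg (sub_neg.2 (hy₂ i hi))]
    · rw [sign_pos (sub_pos.2 hi), sign_pos (sub_pos.2 (hy₁ i hi))]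

section Semilinear

variable {E F : Type*} [AddCommGroup E] [Module ℚ E] [AddCommGroup F] [Module ℚ F]

theorem AffineMap.apply_add (h : E →ᵃ[ℚ] ℚ) (p v : E) : h (p + v) = h p + h.linear v := by
  simpa [add_comm] using h.map_vadd p v

/-- Membership in `W` depends only on the signs of the functions `h i`. -/
def SignInvariant {ι : Type*} (h : ι → (E →ᵃ[ℚ] ℚ)) (W : Set E) : Prop :=
  ∀ p q, (∀ i, SignType.sign (h i p) = SignType.sign (h i q)) → p ∈ W → q ∈ W

/-- Membership in `W` depends only on the signs of finitely many affine functions. -/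
def IsSemilinear (W : Set E) : Prop :=
  ∃ (ι : Type) (_ : Finite ι) (h : ι → (E →ᵃ[ℚ] ℚ)), SignInvariant h W

namespace IsSemilinear

theorem empty : IsSemilinear (∅ : Set E) :=
  ⟨Empty, inferInstance, Empty.elim, fun _ _ _ hp => hp⟩

theorem setOf_eq_zero (h : E →ᵃ[ℚ] ℚ) : IsSemilinear {p | h p = 0} := by
  refine ⟨Unit, inferInstance, fun _ => h, fun p q hpq hp => ?_⟩
  have := hpq ()
  rw [show h p = 0 from hp, sign_zero] at this
  exact sign_eq_zero_iff.1 this.symm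

theorem setOf_pos (h : E →ᵃ[ℚ] ℚ) : IsSemilinear {p | 0 < h p} := by
  refine ⟨Unit, inferInstance, fun _ => h, fun p q hpq hp => ?_⟩
  have := hpq ()
  rw [sign_pos (show 0 < h p from hp)] at this
  exact sign_eq_one_iff.1 this.symm

theorem imp {V W : Set E} (hV : IsSemilinear V) (hW : IsSemilinear W) :
    IsSemilinear {p | p ∈ V → p ∈ W} := by
  obtain ⟨ι, _, f, hf⟩ := hV
  obtain ⟨κ, _, g, hg⟩ := hW
  refine ⟨ι ⊕ κ, inferInstance, Sum.elim f g, fun p q hpq hp hq => ?_⟩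
  exact hg p q (fun i => hpq (Sum.inr i)) (hp (hf q p (fun i => (hpq (Sum.inl i)).symm) hq))

theorem preimage {W : Set F} (hW : IsSemilinear W) (g : E →ᵃ[ℚ] F) : IsSemilinear (g ⁻¹' W) := by
  obtain ⟨ι, hι, h, hh⟩ := hW
  exact ⟨ι, hι, fun i => (h i).comp g, fun p q hpq hp => hh _ _ hpq hp⟩

theorem setOf_forall {W : Set (E × ℚ)} (hW : IsSemilinear W) :
    IsSemilinear {p | ∀ x, (p, x) ∈ W} := by
  obtain ⟨ι, _, h, hh⟩ := hW
  let u : ι → (E →ᵃ[ℚ] ℚ) := fun i => (h i).comp (LinearMap.inl ℚ E ℚ).toAffineMap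
  let c : ι → ℚ := fun i => (h i).linear (0, 1)
  let r : ι → (E →ᵃ[ℚ] ℚ) := fun i => -(c i)⁻¹ • u i
  have hu : ∀ i p x, h i (p, x) = u i p + x * c i := fun i p x => by
    have h1 : (p, x) = ((p, 0) + x • (0, 1) : E × ℚ) := by simp
    rw [h1, AffineMap.apply_add, map_smul]
    rfl
  have hr : ∀ i p x, c i ≠ 0 → h i (p, x) = c i * (x - r i p) := fun i p x hc => by
    rw [hu]
    simp only [r, AffineMap.coe_smul, Pi.smul_apply, smul_eq_mul]
    field_simp
    ring
  refine ⟨ι ⊕ ι × ι, inferInstance, Sum.elim u fun ij => r ij.1 - r ij.2, fun p q hpq hp y => ?_⟩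
  obtain ⟨x, hx⟩ := exists_sign_sub_eq (f := fun i => r i q) (g := fun i => r i p)
    (fun i j => (hpq (Sum.inr (i, j))).symm) y
  refine hh _ _ (fun i => ?_) (hp x)
  by_cases hc : c i = 0
  · simpa [hu, hc] using hpq (Sum.inl i)
  · rw [hr i p x hc, hr i q y hc, sign_mul, sign_mul, hx i]

end IsSemilinear

end Semilinear

open FirstOrder.Language in
theorem exists_affineMap_eq_realize {α : Type*} (t : DOAGLang[[(Set.univ : Set ℚ)]].Term α) :
    ∃ h : (α → ℚ) →ᵃ[ℚ] ℚ, ∀ v, h v = t.realize v := by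
  induction t with
  | var i => exact ⟨AffineMap.proj i, fun v => rfl⟩
  | @func l f ts ih =>
    choose h hh using ih
    rcases f with f | f
    · match l, f with
      | 2, f =>
        refine ⟨h 0 + h 1, fun v => ?_⟩
        simp only [AffineMap.coe_add, Pi.add_apply, hh]
        rfl
    · match l, f with
      | 0, f => exact ⟨AffineMap.const ℚ _ f.1, fun v => rfl⟩

/-- The linear map sending `((v, xs), x)` to `(v, Fin.snoc xs x)`. -/
def snocLinearMap (α : Type*) (n : ℕ) :
    ((α → ℚ) × (Fin n → ℚ)) × ℚ →ₗ[ℚ] (α → ℚ) × (Fin (n + 1) → ℚ) where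
  toFun p := (p.1.1, Fin.snoc p.1.2 p.2)
  map_add' p q := by
    refine Prod.ext rfl (funext fun i => ?_)
    refine Fin.lastCases ?_ (fun i => ?_) i <;> simp
  map_smul' c p := by
    refine Prod.ext rfl (funext fun i => ?_)
    refine Fin.lastCases ?_ (fun i => ?_) i <;> simp

/-- The linear map sending `(v, xs)` to `Sum.elim v xs`. -/
def sumElimLinearMap (α β : Type*) : (α → ℚ) × (β → ℚ) →ₗ[ℚ] (α ⊕ β → ℚ) where
  toFun p := Sum.elim p.1 p.2
  map_add' p q := by ext (i | i) <;> rfl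
  map_smul' c p := by ext (i | i) <;> rfl

open FirstOrder.Language in
theorem isSemilinear_realize {α : Type*} {n : ℕ}
    (φ : DOAGLang[[(Set.univ : Set ℚ)]].BoundedFormula α n) :
    IsSemilinear {p : (α → ℚ) × (Fin n → ℚ) | φ.Realize p.1 p.2} := by
  induction φ with
  | falsum => exact IsSemilinear.empty
  | @equal n t₁ t₂ =>
    obtain ⟨h₁, hh₁⟩ := exists_affineMap_eq_realize t₁
    obtain ⟨h₂, hh₂⟩ := exists_affineMap_eq_realize t₂
    have := (IsSemilinear.setOf_eq_zero (h₁ - h₂)).preimage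
      (sumElimLinearMap α (Fin n)).toAffineMap
    simpa [hh₁, hh₂, sub_eq_zero, sumElimLinearMap, BoundedFormula.Realize] using this
  | @rel n l R ts =>
    rcases R with R | R
    · match l, R with
      | 2, R =>
        obtain ⟨h₁, hh₁⟩ := exists_affineMap_eq_realize (ts 0)
        obtain ⟨h₂, hh₂⟩ := exists_affineMap_eq_realize (ts 1)
        have := (IsSemilinear.setOf_pos (h₂ - h₁)).preimage
          (sumElimLinearMap α (Fin n)).toAffineMap
        simp only [Set.preimage_ofPred_eq, AffineMap.coe_sub, Pi.sub_apply, sub_pos, hh₁, hh₂]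
          at this
        exact this
    · exact R.elim
  | imp _ _ ih₁ ih₂ => exact ih₁.imp ih₂
  | @all n φ ih => exact (ih.preimage (snocLinearMap α n).toAffineMap).setOf_forall

theorem Set.Definable.isSemilinear {α : Type*} {s : Set (α → ℚ)}
    (hs : Set.Definable (Set.univ : Set ℚ) DOAGLang s) : IsSemilinear s := by
  obtain ⟨φ, rfl⟩ := hs
  have h := (isSemilinear_realize φ).preimage (LinearMap.inl ℚ (α → ℚ) (Fin 0 → ℚ)).toAffineMap
  convert h using 1
  ext v
  exact iff_of_eq (congrArg (FirstOrder.Language.BoundedFormula.Realize φ v) (Subsingleton.elim _ _))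

/-! ### Affine functions with rational coefficients in the language -/

theorem AffineMap.apply_eq_sum {k : ℕ} (h : (Fin k → ℚ) →ᵃ[ℚ] ℚ) (v : Fin k → ℚ) :
    h v = ∑ i, h.linear (Pi.single i 1) * v i + h 0 := by
  rw [← zero_add v, AffineMap.apply_add, add_comm, zero_add]
  congr 1
  conv_lhs => rw [pi_eq_sum_univ' v, map_sum]
  refine Finset.sum_congr rfl fun i _ => ?_
  rw [map_smul, smul_eq_mul, mul_comm]

theorem exists_int_multiples {k : ℕ} (q : Fin k → ℚ) :
    ∃ (N : ℚ) (a : Fin k → ℤ), 0 < N ∧ ∀ i, N * q i = a i := by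
  refine ⟨∏ i, ((q i).den : ℚ), fun i => (q i).num * ∏ j ∈ Finset.univ.erase i, ((q j).den : ℤ),
    Finset.prod_pos fun i _ => by exact_mod_cast (q i).pos, fun i => ?_⟩
  rw [← Finset.mul_prod_erase _ _ (Finset.mem_univ i)]
  push_cast
  rw [mul_right_comm, Rat.den_mul_eq_num]

theorem exists_int_coeffs {k : ℕ} (h : (Fin k → ℚ) →ᵃ[ℚ] ℚ) :
    ∃ (N : ℚ) (a : Fin k → ℤ) (c : ℚ), 0 < N ∧ ∀ v, N * h v = ∑ i, (a i : ℚ) * v i + c := by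
  obtain ⟨N, a, hN, ha⟩ := exists_int_multiples fun i => h.linear (Pi.single i 1)
  refine ⟨N, a, N * h 0, hN, fun v => ?_⟩
  rw [AffineMap.apply_eq_sum, mul_add, Finset.mul_sum]
  simp only [← mul_assoc, ha]

namespace DOAGEquational

variable {k : ℕ}

theorem setOf_eq_zero (h : (Fin k → ℚ) →ᵃ[ℚ] ℚ) : DOAGEquational k {v | h v = 0} := by
  obtain ⟨N, a, c, hN, ha⟩ := exists_int_coeffs h
  convert linear a (-c) using 1
  ext v
  have := ha v
  simp only [Set.mem_ofPred_eq]
  rw [eq_neg_iff_add_eq_zero, ← this, mul_eq_zero, or_iff_right hN.ne']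

theorem inter {s t : Set (Fin k → ℚ)} (hs : DOAGEquational k s) (ht : DOAGEquational k t) :
    DOAGEquational k (s ∩ t) := by
  simpa [Set.compl_union] using (hs.compl.union ht.compl).compl

theorem univ : DOAGEquational k Set.univ := by
  simpa using linear (0 : Fin k → ℤ) 0

theorem iInter {ι : Type*} [Finite ι] {s : ι → Set (Fin k → ℚ)}
    (h : ∀ i, DOAGEquational k (s i)) : DOAGEquational k (⋂ i, s i) := by
  classical
  have := Fintype.ofFinite ι
  suffices ∀ t : Finset ι, DOAGEquational k (⋂ i ∈ t, s i) by simpa using this Finset.univ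
  intro t
  induction t using Finset.induction_on with
  | empty => simpa using univ
  | insert i t _ ih => simpa using (h i).inter ih

end DOAGEquational

section Terms

open FirstOrder.Language

/-- The symbol `+`. -/
def DOAGLang.addSymb : DOAGLang.Functions 2 := ()

/-- The symbol `<`. -/
def DOAGLang.ltSymb : DOAGLang.Relations 2 := ()

variable {α : Type*}

/-- The function `f` is given by a term with parameters. -/
def IsTermFun (f : (α → ℚ) → ℚ) : Prop :=
  ∃ t : DOAGLang[[(Set.univ : Set ℚ)]].Term α, ∀ v, t.realize v = f v

namespace IsTermFun

theorem const (c : ℚ) : IsTermFun fun _ : α → ℚ => c :=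
  ⟨(DOAGLang.con (⟨c, Set.mem_univ c⟩ : (Set.univ : Set ℚ))).term, fun _ => by simp⟩

theorem proj (i : α) : IsTermFun fun v : α → ℚ => v i :=
  ⟨Term.var i, fun _ => rfl⟩

theorem add {f g : (α → ℚ) → ℚ} (hf : IsTermFun f) (hg : IsTermFun g) :
    IsTermFun fun v => f v + g v := by
  obtain ⟨s, hs⟩ := hf
  obtain ⟨t, ht⟩ := hg
  refine ⟨Term.func (l := 2) (Sum.inl DOAGLang.addSymb) ![s, t], fun v => ?_⟩
  change s.realize v + t.realize v = f v + g v
  rw [hs, ht]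

theorem nat_mul {f : (α → ℚ) → ℚ} (hf : IsTermFun f) (n : ℕ) : IsTermFun fun v => (n : ℚ) * f v := by
  induction n with
  | zero => simpa using const 0
  | succ n ih => simpa [add_mul] using ih.add hf

theorem sum {ι : Type*} (s : Finset ι) {f : ι → (α → ℚ) → ℚ} (hf : ∀ i, IsTermFun (f i)) :
    IsTermFun fun v => ∑ i ∈ s, f i v := by
  classical
  induction s using Finset.induction_on with
  | empty => simpa using const 0
  | insert i s hi ih => simpa [Finset.sum_insert hi] using (hf i).add ih

theorem definable_lt {f g : (α → ℚ) → ℚ} (hf : IsTermFun f) (hg : IsTermFun g) :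
    Set.Definable (Set.univ : Set ℚ) DOAGLang {v | f v < g v} := by
  obtain ⟨s, hs⟩ := hf
  obtain ⟨t, ht⟩ := hg
  refine ⟨Relations.formula₂ (Sum.inl DOAGLang.ltSymb : DOAGLang[[(Set.univ : Set ℚ)]].Relations 2) s t, ?_⟩
  ext v
  refine Iff.trans ?_ Formula.realize_rel₂.symm
  change f v < g v ↔ s.realize v < t.realize v
  rw [hs, ht]

end IsTermFun

end Terms

theorem definable_setOf_pos {k : ℕ} (h : (Fin k → ℚ) →ᵃ[ℚ] ℚ) :
    Set.Definable (Set.univ : Set ℚ) DOAGLang {v | 0 < h v} := by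
  obtain ⟨N, a, c, hN, ha⟩ := exists_int_coeffs h
  convert IsTermFun.definable_lt
    (IsTermFun.sum Finset.univ fun i => (IsTermFun.proj i).nat_mul (-a i).toNat)
    ((IsTermFun.sum Finset.univ fun i => (IsTermFun.proj i).nat_mul (a i).toNat).add
      (IsTermFun.const c)) using 1
  ext v
  have key : N * h v = (∑ i, ((a i).toNat : ℚ) * v i + c) - ∑ i, ((-a i).toNat : ℚ) * v i := by
    rw [ha, add_sub_right_comm, ← Finset.sum_sub_distrib]
    congr 1
    refine Finset.sum_congr rfl fun i _ => ?_
    rw [← sub_mul]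
    congr 1
    exact_mod_cast (Int.toNat_sub_toNat_neg (a i)).symm
  rw [Set.mem_ofPred_eq, Set.mem_ofPred_eq, ← sub_pos (b := ∑ i, _), ← key, mul_pos_iff_of_pos_left hN]

theorem definable_setOf_sign_eq {k : ℕ} (h : (Fin k → ℚ) →ᵃ[ℚ] ℚ) (σ : SignType) :
    Set.Definable (Set.univ : Set ℚ) DOAGLang {v | SignType.sign (h v) = σ} := by
  have hneg : Set.Definable (Set.univ : Set ℚ) DOAGLang {v | h v < 0} := by
    simpa using definable_setOf_pos (-h)
  cases σ with
  | pos => simpa [sign_eq_one_iff] using definable_setOf_pos h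
  | neg => simpa [sign_eq_neg_one_iff] using hneg
  | zero =>
    convert ((definable_setOf_pos h).union hneg).compl using 1
    ext v
    simp [le_antisymm_iff]

/-! ### Sign patterns of affine functions on a product -/

/-- An affine function with values `x` at `0` and `y` at `1` vanishes at `x / (x - y)`. -/
theorem add_mul_sub_eq {K : Type*} [Field K] {x y c : K} (h : x ≠ y) :
    x + c * (y - x) = (x - y) * (x / (x - y) - c) := by
  have := sub_ne_zero.2 h
  field_simp
  ring

section Sign

variable {K : Type*} [Field K] [LinearOrder K] [IsStrictOrderedRing K] {x y c : K}

theorem sign_add_of_abs_lt (h : |y| < |x|) : SignType.sign (x + y) = SignType.sign x := by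
  obtain ⟨h₁, h₂⟩ := abs_lt.1 h
  rcases lt_trichotomy x 0 with hx | rfl | hx
  · rw [abs_of_neg hx] at h₁ h₂
    rw [sign_neg hx, sign_neg (by linarith)]
  · simp at h
    exact absurd h (abs_nonneg y).not_gt
  · rw [abs_of_pos hx] at h₁ h₂
    rw [sign_pos hx, sign_pos (by linarith)]

theorem sign_eq_of_mul_pos (h : 0 < x * y) : SignType.sign x = SignType.sign y := by
  rcases pos_and_pos_or_neg_and_neg_of_mul_pos h with ⟨hx, hy⟩ | ⟨hx, hy⟩
  · rw [sign_pos hx, sign_pos hy]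
  · rw [sign_neg hx, sign_neg hy]

theorem mul_neg_of_sign_ne (hx : x ≠ 0) (hy : y ≠ 0)
    (h : SignType.sign x ≠ SignType.sign y) : x * y < 0 :=
  (mul_ne_zero hx hy).lt_or_gt.resolve_right fun h' => h (sign_eq_of_mul_pos h')

theorem sign_add_mul_sub (h : SignType.sign x = SignType.sign y) (hc₀ : 0 < c) (hc₁ : c < 1) :
    SignType.sign (x + c * (y - x)) = SignType.sign x := by
  rcases lt_trichotomy x 0 with hx | rfl | hx
  · have hy : y < 0 := sign_eq_neg_one_iff.1 (h.symm.trans (sign_neg hx))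
    rw [sign_neg hx, sign_neg (by nlinarith)]
  · have hy : y = 0 := sign_eq_zero_iff.1 (h.symm.trans sign_zero)
    simp [hy]
  · have hy : 0 < y := sign_eq_one_iff.1 (h.symm.trans (sign_pos hx))
    rw [sign_pos hx, sign_pos (by nlinarith)]

theorem div_sub_mem_Ioo (h : x * y < 0) : x / (x - y) ∈ Set.Ioo 0 1 := by
  rcases mul_neg_iff.1 h with ⟨hx, hy⟩ | ⟨hx, hy⟩
  · exact ⟨div_pos hx (by linarith), (div_lt_one (by linarith)).2 (by linarith)⟩
  · exact ⟨div_pos_of_neg_of_neg hx (by linarith),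
      (div_lt_one_of_neg (by linarith)).2 (by linarith)⟩

end Sign

section Perturb

variable {E : Type*} [AddCommGroup E] [Module ℚ E] {ι κ : Type*}

theorem AffineMap.apply_add_smul_sub (f : E →ᵃ[ℚ] ℚ) (p q : E) (c : ℚ) :
    f (p + c • (q - p)) = f p + c * (f q - f p) := by
  have h := f.apply_add p (q - p)
  rw [add_sub_cancel] at h
  rw [AffineMap.apply_add, map_smul, smul_eq_mul, h, add_sub_cancel_left]

theorem exists_pos_sign_apply_add_eq [Finite ι] (f : ι → (E →ᵃ[ℚ] ℚ)) (r d e : E) :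
    ∃ ε : ℚ, 0 < ε ∧ ∀ s t : ℚ, |s| ≤ ε → |t| ≤ ε → ∀ i, f i r ≠ 0 →
      SignType.sign (f i (r + s • d + t • e)) = SignType.sign (f i r) := by
  have key : ∀ i, ∀ᶠ ε in nhdsWithin (0 : ℚ) (Set.Ioi 0), f i r ≠ 0 → ∀ s t : ℚ, |s| ≤ ε →
      |t| ≤ ε → SignType.sign (f i (r + s • d + t • e)) = SignType.sign (f i r) := by
    intro i
    by_cases hi : f i r = 0
    · simp [hi]
    set a := (f i).linear d
    set b := (f i).linear e
    have hM : 0 < |a| + |b| + 1 := by positivity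
    have h0 : 0 < |f i r| / (|a| + |b| + 1) := div_pos (abs_pos.2 hi) hM
    filter_upwards [Ioo_mem_nhdsGT h0] with ε hε _ s t hs ht
    rw [AffineMap.apply_add, AffineMap.apply_add, map_smul, map_smul, add_assoc]
    apply sign_add_of_abs_lt
    have h1 : ε * (|a| + |b| + 1) < |f i r| := (lt_div_iff₀ hM).1 hε.2
    calc |s • a + t • b| ≤ |s * a| + |t * b| := abs_add_le _ _
      _ = |s| * |a| + |t| * |b| := by rw [abs_mul, abs_mul]
      _ ≤ ε * |a| + ε * |b| := by gcongr
      _ < |f i r| := by linarith [hε.1]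
  obtain ⟨ε, hε, hε₀⟩ := ((Filter.eventually_all.2 key).and self_mem_nhdsWithin).exists
  exact ⟨ε, hε₀, fun s t hs ht i hi => hε i hi s t hs ht⟩

/-- A point of a flat can be moved within the flat, keeping nonzero signs, so as to avoid
finitely many proper hyperplanes. -/
theorem exists_generic_point [Finite ι] [Finite κ] (h : ι → (E →ᵃ[ℚ] ℚ)) (g : κ → (E →ᵃ[ℚ] ℚ))
    (S : Set ι) {q : E} (hq : ∀ k ∈ S, h k q = 0) :
    ∃ q', (∀ k ∈ S, h k q' = 0) ∧
      (∀ i, h i q ≠ 0 → SignType.sign (h i q') = SignType.sign (h i q)) ∧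
      ∀ j, (∃ w, (∀ k ∈ S, h k w = 0) ∧ g j w ≠ 0) → g j q' ≠ 0 := by
  classical
  have := Fintype.ofFinite κ
  suffices ∀ s : Finset κ, ∃ q', (∀ k ∈ S, h k q' = 0) ∧
      (∀ i, h i q ≠ 0 → SignType.sign (h i q') = SignType.sign (h i q)) ∧
      ∀ j ∈ s, (∃ w, (∀ k ∈ S, h k w = 0) ∧ g j w ≠ 0) → g j q' ≠ 0 by
    simpa using this Finset.univ
  intro s
  induction s using Finset.induction_on with
  | empty => exact ⟨q, hq, fun _ _ => rfl, by simp⟩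
  | insert a s _ ih =>
    obtain ⟨q', hq'S, hq'h, hq'g⟩ := ih
    by_cases ha : (∃ w, (∀ k ∈ S, h k w = 0) ∧ g a w ≠ 0) ∧ g a q' = 0
    · obtain ⟨⟨w, hwS, hw⟩, ha⟩ := ha
      obtain ⟨ε, hε, hsign⟩ := exists_pos_sign_apply_add_eq (Sum.elim h g) q' (w - q') 0
      have hsign' := hsign ε 0 (abs_of_pos hε).le (by simpa using hε.le)
      simp only [smul_zero, add_zero] at hsign'
      refine ⟨q' + ε • (w - q'), fun k hk => ?_, fun i hi => ?_, fun j hj hjw => ?_⟩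
      · rw [AffineMap.apply_add_smul_sub, hq'S k hk, hwS k hk]
        simp
      · have hi' : h i q' ≠ 0 := by
          rw [← sign_ne_zero, hq'h i hi]
          exact sign_ne_zero.2 hi
        exact (hsign' (Sum.inl i) hi').trans (hq'h i hi)
      · rcases Finset.mem_insert.1 hj with rfl | hj
        · rw [AffineMap.apply_add_smul_sub, ha]
          simpa using ⟨hε.ne', hw⟩
        · have := hq'g j hj hjw
          rw [← sign_ne_zero]
          exact (hsign' (Sum.inr j) this).trans_ne (sign_ne_zero.2 this)
    · refine ⟨q', hq'S, hq'h, fun j hj hjw => ?_⟩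
      rcases Finset.mem_insert.1 hj with rfl | hj
      · exact fun h0 => ha ⟨hjw, h0⟩
      · exact hq'g j hj hjw

theorem exists_eq_on_flat_of_linear_comp [Finite ι] {V : Type*} [AddCommGroup V] [Module ℚ V]
    (h : ι → (E →ᵃ[ℚ] ℚ)) (S : Set ι) (f : E →ᵃ[ℚ] ℚ) (j : V →ₗ[ℚ] E)
    (hf : ∀ a, (∀ k ∈ S, (h k).linear (j a) = 0) → f.linear (j a) = 0) :
    ∃ g : E →ᵃ[ℚ] ℚ, (∀ a, g.linear (j a) = 0) ∧ ∀ p, (∀ k ∈ S, h k p = 0) → f p = g p := by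
  let φ : (E →ᵃ[ℚ] ℚ) →ₗ[ℚ] (V →ₗ[ℚ] ℚ) :=
    { toFun := fun f => f.linear.comp j
      map_add' := fun _ _ => rfl
      map_smul' := fun _ _ => rfl }
  have hmem : φ f ∈ Submodule.span ℚ (Set.range fun k : S => φ (h k)) := by
    refine mem_span_of_iInf_ker_le_ker fun a ha => hf a fun k hk => ?_
    simp only [Submodule.mem_iInf] at ha
    exact ha ⟨k, hk⟩
  have hrange : (Set.range fun k : S => φ (h k)) = φ '' Set.range fun k : S => h k := by
    rw [← Set.range_comp]
    rfl
  rw [hrange, Submodule.span_image] at hmem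
  obtain ⟨f', hf', hff'⟩ := hmem
  refine ⟨f - f', fun a => ?_, fun p hp => ?_⟩
  · have : f'.linear (j a) = f.linear (j a) := LinearMap.congr_fun hff' a
    simp [this]
  · suffices f' p = 0 by simp [this]
    clear hff'
    induction hf' using Submodule.span_induction with
    | mem x hx =>
      obtain ⟨k, rfl⟩ := hx
      exact hp k k.2
    | zero => rfl
    | add x y _ _ hx hy => simp [hx, hy]
    | smul c x _ hx => simp [hx]

end Perturb

section Product

variable {A B : Type*} [AddCommGroup A] [Module ℚ A] [AddCommGroup B] [Module ℚ B] {ι : Type*}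

/-- On the flat where all `h k`, `k ∈ S`, vanish, the function `h i` varies both along
the first and along the second factor. -/
def MixedOn (h : ι → (A × B →ᵃ[ℚ] ℚ)) (S : Set ι) (i : ι) : Prop :=
  (∃ a : A, (∀ k ∈ S, (h k).linear (a, 0) = 0) ∧ (h i).linear (a, 0) ≠ 0) ∧
    ∃ b : B, (∀ k ∈ S, (h k).linear (0, b) = 0) ∧ (h i).linear (0, b) ≠ 0

theorem exists_eq_fst_or_snd_of_not_mixedOn [Finite ι] {h : ι → (A × B →ᵃ[ℚ] ℚ)} {S : Set ι}
    {i : ι} (hi : ¬ MixedOn h S i) :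
    ∃ (u : A →ᵃ[ℚ] ℚ) (v : B →ᵃ[ℚ] ℚ), (∀ p, (∀ k ∈ S, h k p = 0) → h i p = u p.1) ∨
      ∀ p, (∀ k ∈ S, h k p = 0) → h i p = v p.2 := by
  rw [MixedOn, not_and_or] at hi
  push Not at hi
  rcases hi with hi | hi
  · obtain ⟨g, hg, hgp⟩ := exists_eq_on_flat_of_linear_comp h S (h i) (LinearMap.inl ℚ A B) hi
    refine ⟨0, g.comp (LinearMap.inr ℚ A B).toAffineMap, Or.inr fun p hp => ?_⟩
    have h1 := g.apply_add (0, p.2) (LinearMap.inl ℚ A B p.1)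
    rw [hg] at h1
    rw [hgp p hp]
    simpa using h1
  · obtain ⟨g, hg, hgp⟩ := exists_eq_on_flat_of_linear_comp h S (h i) (LinearMap.inr ℚ A B) hi
    refine ⟨g.comp (LinearMap.inl ℚ A B).toAffineMap, 0, Or.inl fun p hp => ?_⟩
    have h1 := g.apply_add (p.1, 0) (LinearMap.inr ℚ A B p.2)
    rw [hg] at h1
    rw [hgp p hp]
    simpa using h1

variable [Finite ι] {h : ι → (A × B →ᵃ[ℚ] ℚ)} {D : Set (A × B)}

/-- If all functions separating `p ∈ D` from `q ∉ D` are proportional to a single mixed one,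
then there is a half-graph near the point where the segment from `p` to `q` crosses its
zero set. -/
theorem not_isStable_of_separated (hD : SignInvariant h D) {S : Set ι} {p q : A × B}
    (hp : ∀ i, h i p = 0 ↔ i ∈ S) (hq : ∀ i, h i q = 0 ↔ i ∈ S) (hpD : p ∈ D) (hqD : q ∉ D)
    {i : ι} (hi : SignType.sign (h i p) ≠ SignType.sign (h i q)) (hmix : MixedOn h S i)
    (hprop : ∀ k, SignType.sign (h k p) ≠ SignType.sign (h k q) →
      ∀ w, (∀ k ∈ S, h k w = 0) → h i p * h k w = h k p * h i w) :
    ¬ IsStable D := by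
  have hneg : ∀ k, SignType.sign (h k p) ≠ SignType.sign (h k q) → h k p * h k q < 0 := by
    intro k hk
    have hkS : k ∉ S := fun hkS => hk (by rw [(hp k).2 hkS, (hq k).2 hkS])
    exact mul_neg_of_sign_ne (mt (hp k).1 hkS) (mt (hq k).1 hkS) hk
  have hpi : h i p ≠ 0 := left_ne_zero_of_mul (hneg i hi).ne
  obtain ⟨⟨a₀, ha₀S, ha₀⟩, ⟨b₀, hb₀S, hb₀⟩⟩ := hmix
  obtain ⟨a, haS, ha⟩ : ∃ a : A, (∀ k ∈ S, (h k).linear (a, 0) = 0) ∧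
      (h i).linear (a, 0) = h i p := by
    have hsm : ∀ c : ℚ, ((c • a₀, 0) : A × B) = c • (a₀, 0) := fun c => by simp
    refine ⟨(h i p / (h i).linear (a₀, 0)) • a₀, fun k hk => ?_, ?_⟩
    · rw [hsm, map_smul, ha₀S k hk, smul_zero]
    · rw [hsm, map_smul, smul_eq_mul, div_mul_cancel₀ _ ha₀]
  obtain ⟨b, hbS, hb⟩ : ∃ b : B, (∀ k ∈ S, (h k).linear (0, b) = 0) ∧
      (h i).linear (0, b) = -h i p := by
    have hsm : ∀ c : ℚ, ((0, c • b₀) : A × B) = c • (0, b₀) := fun c => by simp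
    refine ⟨(-h i p / (h i).linear (0, b₀)) • b₀, fun k hk => ?_, ?_⟩
    · rw [hsm, map_smul, hb₀S k hk, smul_zero]
    · rw [hsm, map_smul, smul_eq_mul, div_mul_cancel₀ _ hb₀]
  have hc := div_sub_mem_Ioo (hneg i hi)
  set c := h i p / (h i p - h i q)
  set r := p + c • (q - p)
  have hr : ∀ k, h k r = h k p + c * (h k q - h k p) := fun k =>
    AffineMap.apply_add_smul_sub _ _ _ _
  have hri : h i r = 0 := by
    rw [hr, add_mul_sub_eq fun heq => hi (by rw [heq]), sub_self, mul_zero]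
  obtain ⟨ε, hε, hsign⟩ := exists_pos_sign_apply_add_eq h r (a, 0) (0, b)
  have hzS : ∀ s t : ℚ, ∀ k ∈ S, h k (r + s • (a, 0) + t • (0, b)) = 0 := by
    intro s t k hk
    rw [AffineMap.apply_add, AffineMap.apply_add, map_smul, map_smul, haS k hk, hbS k hk, hr,
      (hp k).2 hk, (hq k).2 hk]
    simp
  have hzsep : ∀ s t : ℚ, ∀ k, SignType.sign (h k p) ≠ SignType.sign (h k q) →
      h k (r + s • (a, 0) + t • (0, b)) = h k p * (s - t) := by
    intro s t k hk
    have h1 := hprop k hk _ (hzS s t)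
    have h2 : h i (r + s • (a, 0) + t • (0, b)) = h i p * (s - t) := by
      rw [AffineMap.apply_add, AffineMap.apply_add, map_smul, map_smul, ha, hb, hri, smul_eq_mul,
        smul_eq_mul]
      ring
    rw [h2] at h1
    exact mul_left_cancel₀ hpi (by linear_combination h1)
  have hznsep : ∀ s t : ℚ, |s| ≤ ε → |t| ≤ ε → ∀ k,
      SignType.sign (h k p) = SignType.sign (h k q) →
      SignType.sign (h k (r + s • (a, 0) + t • (0, b))) = SignType.sign (h k p) := by
    intro s t hs ht k hk
    by_cases hkS : k ∈ S
    · rw [hzS s t k hkS, (hp k).2 hkS]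
    · have h1 : SignType.sign (h k r) = SignType.sign (h k p) := by
        rw [hr]
        exact sign_add_mul_sub hk hc.1 hc.2
      rw [← h1]
      refine hsign s t hs ht k ?_
      rw [← sign_ne_zero, h1]
      exact sign_ne_zero.2 (mt (hp k).1 hkS)
  have hzp : ∀ s t : ℚ, |s| ≤ ε → |t| ≤ ε → t < s → r + s • (a, 0) + t • (0, b) ∈ D := by
    intro s t hs ht hst
    refine hD p _ (fun k => ?_) hpD
    by_cases hk : SignType.sign (h k p) = SignType.sign (h k q)
    · exact (hznsep s t hs ht k hk).symm
    · rw [hzsep s t k hk, sign_mul, sign_pos (sub_pos.2 hst), mul_one]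
  have hzq : ∀ s t : ℚ, |s| ≤ ε → |t| ≤ ε → s < t → r + s • (a, 0) + t • (0, b) ∉ D := by
    intro s t hs ht hst hz
    refine hqD (hD _ q (fun k => ?_) hz)
    by_cases hk : SignType.sign (h k p) = SignType.sign (h k q)
    · exact (hznsep s t hs ht k hk).trans hk
    · rw [hzsep s t k hk]
      refine sign_eq_of_mul_pos ?_
      have := mul_pos_of_neg_of_neg (hneg k hk) (sub_neg.2 hst)
      linarith
  have hz : ∀ s t : ℚ, (r.1 + s • a, r.2 + t • b) = r + s • (a, 0) + t • (0, b) := fun s t => by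
    ext <;> simp
  have hbound : ∀ d : ℚ, 1 ≤ d → |ε / d| ≤ ε := fun d hd => by
    rw [abs_of_nonneg (by positivity)]
    exact div_le_self hε.le hd
  refine not_not.2 ⟨fun j => r.1 + (ε / (2 * j + 1)) • a, fun l => r.2 + (ε / (2 * l + 2)) • b,
    fun j l => ?_⟩
  rw [hz]
  have hj : (0 : ℚ) ≤ j := j.cast_nonneg
  have hl : (0 : ℚ) ≤ l := l.cast_nonneg
  constructor
  · intro hmem
    by_contra! hlt
    have hlt' : (l : ℚ) + 1 ≤ j := by exact_mod_cast hlt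
    refine hzq _ _ (hbound _ (by linarith)) (hbound _ (by linarith)) ?_ hmem
    exact div_lt_div_of_pos_left hε (by linarith) (by linarith)
  · intro hle
    have hle' : (j : ℚ) ≤ l := by exact_mod_cast hle
    refine hzp _ _ (hbound _ (by linarith)) (hbound _ (by linarith)) ?_
    exact div_lt_div_of_pos_left hε (by linarith) (by linarith)

theorem mem_of_separated_mixedOn (hD : SignInvariant h D) (hst : IsStable D) {S : Set ι} (n : ℕ) :
    ∀ p q : A × B, (∀ i, h i p = 0 ↔ i ∈ S) → (∀ i, h i q = 0 ↔ i ∈ S) →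
      (∀ i, SignType.sign (h i p) ≠ SignType.sign (h i q) → MixedOn h S i) →
      {i | SignType.sign (h i p) ≠ SignType.sign (h i q)}.ncard = n → p ∈ D → q ∈ D := by
  induction n using Nat.strong_induction_on with
  | _ n ih =>
  intro p q₀ hp hq₀ hmix₀ hcard₀ hpD
  obtain ⟨q, hqS, hqsign, hqgen⟩ := exists_generic_point h
    (fun ij : ι × ι => h ij.1 p • h ij.2 - h ij.2 p • h ij.1) S fun k hk => (hq₀ k).2 hk
  have hqq₀ : ∀ i, SignType.sign (h i q) = SignType.sign (h i q₀) := by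
    intro i
    by_cases hi : i ∈ S
    · rw [hqS i hi, (hq₀ i).2 hi]
    · exact hqsign i (mt (hq₀ i).1 hi)
  have hq : ∀ i, h i q = 0 ↔ i ∈ S := fun i => by
    rw [← hq₀, ← sign_eq_zero_iff, hqq₀, sign_eq_zero_iff]
  simp only [← hqq₀] at hmix₀ hcard₀
  refine hD q q₀ hqq₀ ?_
  by_cases hsep : ∃ i j, SignType.sign (h i p) ≠ SignType.sign (h i q) ∧
      SignType.sign (h j p) ≠ SignType.sign (h j q) ∧
      h i p / (h i p - h i q) < h j p / (h j p - h j q)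
  · obtain ⟨i, j, hi, hj, hij⟩ := hsep
    have hneg : ∀ k, SignType.sign (h k p) ≠ SignType.sign (h k q) → h k p * h k q < 0 := by
      intro k hk
      have hkS : k ∉ S := fun hkS => hk (by rw [(hp k).2 hkS, (hq k).2 hkS])
      exact mul_neg_of_sign_ne (mt (hp k).1 hkS) (mt (hq k).1 hkS) hk
    obtain ⟨c, ⟨hic, hcj⟩, hcr⟩ := ((Set.Ioo_infinite hij).sdiff
      (Set.finite_range fun k => h k p / (h k p - h k q))).nonempty
    have hc₀ : 0 < c := (div_sub_mem_Ioo (hneg i hi)).1.trans hic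
    have hc₁ : c < 1 := hcj.trans (div_sub_mem_Ioo (hneg j hj)).2
    set s := p + c • (q - p)
    have hs : ∀ k, h k s = h k p + c * (h k q - h k p) := fun k =>
      AffineMap.apply_add_smul_sub _ _ _ _
    have hsnsep : ∀ k, SignType.sign (h k p) = SignType.sign (h k q) →
        SignType.sign (h k s) = SignType.sign (h k p) := fun k hk => by
      rw [hs]
      exact sign_add_mul_sub hk hc₀ hc₁
    have hssep : ∀ k, SignType.sign (h k p) ≠ SignType.sign (h k q) →
        h k s = (h k p - h k q) * (h k p / (h k p - h k q) - c) := fun k hk => by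
      rw [hs, add_mul_sub_eq fun heq => hk (by rw [heq])]
    have hsS : ∀ k, h k s = 0 ↔ k ∈ S := by
      intro k
      by_cases hk : SignType.sign (h k p) = SignType.sign (h k q)
      · rw [← hp, ← sign_eq_zero_iff, hsnsep k hk, sign_eq_zero_iff]
      · have h1 : h k s ≠ 0 := by
          rw [hssep k hk]
          refine mul_ne_zero (sub_ne_zero.2 fun heq => hk (by rw [heq])) (sub_ne_zero.2 ?_)
          exact fun heq => hcr ⟨k, heq⟩
        exact iff_of_false h1 fun hkS => hk (by rw [(hp k).2 hkS, (hq k).2 hkS])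
    have hjs : SignType.sign (h j p) = SignType.sign (h j s) := by
      refine sign_eq_of_mul_pos ?_
      rw [hssep j hj, ← mul_assoc]
      refine mul_pos ?_ (sub_pos.2 hcj)
      nlinarith [hneg j hj, sq_nonneg (h j p)]
    have his : SignType.sign (h i s) = SignType.sign (h i q) := by
      refine sign_eq_of_mul_pos ?_
      rw [hssep i hi, mul_right_comm]
      refine mul_pos_of_neg_of_neg ?_ (sub_neg.2 hic)
      nlinarith [hneg i hi, sq_nonneg (h i q)]
    have hps : ∀ k, SignType.sign (h k p) ≠ SignType.sign (h k s) →
        SignType.sign (h k p) ≠ SignType.sign (h k q) :=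
      fun k hk hk' => hk (hsnsep k hk').symm
    have hsq : ∀ k, SignType.sign (h k s) ≠ SignType.sign (h k q) →
        SignType.sign (h k p) ≠ SignType.sign (h k q) :=
      fun k hk hk' => hk ((hsnsep k hk').trans hk')
    subst hcard₀
    have hsD : s ∈ D := ih _ (Set.ncard_lt_ncard ⟨hps, fun hsub => hsub hj hjs⟩) p s hp hsS
      (fun k hk => hmix₀ k (hps k hk)) rfl hpD
    exact ih _ (Set.ncard_lt_ncard ⟨hsq, fun hsub => hsub hi his⟩) s q hsS hq
      (fun k hk => hmix₀ k (hsq k hk)) rfl hsD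
  · push Not at hsep
    by_contra hqD
    obtain ⟨i, hi⟩ : ∃ i, SignType.sign (h i p) ≠ SignType.sign (h i q) := by
      by_contra! hall
      exact hqD (hD p q hall hpD)
    refine not_isStable_of_separated hD hp hq hpD hqD hi (hmix₀ i hi) (fun k hk w hw => ?_) hst
    by_contra hne
    refine hqgen (i, k) ⟨w, hw, ?_⟩ ?_
    · simpa [sub_eq_zero] using hne
    · have h1 := le_antisymm (hsep i k hi hk) (hsep k i hk hi)
      rw [div_eq_div_iff (sub_ne_zero.2 fun heq => hk (by rw [heq]))
        (sub_ne_zero.2 fun heq => hi (by rw [heq]))] at h1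
      simp only [AffineMap.coe_sub, AffineMap.coe_smul, Pi.sub_apply, Pi.smul_apply, smul_eq_mul]
      linear_combination h1

/-- Membership in a stable semilinear subset of a product depends only on the vanishing of
finitely many affine functions and on the signs of finitely many affine functions of
each of the two coordinates. -/
theorem exists_sign_invariant_of_isStable (hD : SignInvariant h D) (hst : IsStable D) :
    ∃ (u : Set ι × ι → (A →ᵃ[ℚ] ℚ)) (v : Set ι × ι → (B →ᵃ[ℚ] ℚ)), ∀ p q : A × B,
      (∀ i, h i p = 0 ↔ h i q = 0) →
      (∀ j, SignType.sign (u j p.1) = SignType.sign (u j q.1)) →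
      (∀ j, SignType.sign (v j p.2) = SignType.sign (v j q.2)) → p ∈ D → q ∈ D := by
  have key : ∀ j : Set ι × ι, ∃ (u : A →ᵃ[ℚ] ℚ) (v : B →ᵃ[ℚ] ℚ), ¬ MixedOn h j.1 j.2 →
      (∀ p, (∀ k ∈ j.1, h k p = 0) → h j.2 p = u p.1) ∨
      ∀ p, (∀ k ∈ j.1, h k p = 0) → h j.2 p = v p.2 := by
    intro j
    by_cases hj : MixedOn h j.1 j.2
    · exact ⟨0, 0, fun hj' => absurd hj hj'⟩
    · obtain ⟨u, v, huv⟩ := exists_eq_fst_or_snd_of_not_mixedOn hj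
      exact ⟨u, v, fun _ => huv⟩
  choose u v huv using key
  refine ⟨u, v, fun p q hpq hu hv => ?_⟩
  refine mem_of_separated_mixedOn hD hst (S := {i | h i p = 0}) _ p q (fun _ => Iff.rfl)
    (fun i => (hpq i).symm) (fun i hi => ?_) rfl
  by_contra hmix
  have hqS : ∀ k ∈ {i | h i p = 0}, h k q = 0 := fun k hk => (hpq k).1 hk
  rcases huv (_, i) hmix with h1 | h1
  · exact hi (by rw [h1 p fun _ hk => hk, h1 q hqS, hu])
  · exact hi (by rw [h1 p fun _ hk => hk, h1 q hqS, hv])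

end Product

/-! ### The main theorem -/

/-- The linear map underlying `joinQ`. -/
def joinLinearMap (m n : ℕ) : (Fin (m + n) → ℚ) →ₗ[ℚ] (Fin m → ℚ) × (Fin n → ℚ) where
  toFun := joinQ m n
  map_add' _ _ := rfl
  map_smul' _ _ := rfl

/-- Concatenation of vectors as a linear map. -/
def appendLinearMap (m n : ℕ) : (Fin m → ℚ) × (Fin n → ℚ) →ₗ[ℚ] (Fin (m + n) → ℚ) where
  toFun p := Fin.append p.1 p.2
  map_add' p q := by
    ext i
    refine Fin.addCases (fun i => ?_) (fun i => ?_) i <;> simp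
  map_smul' c p := by
    ext i
    refine Fin.addCases (fun i => ?_) (fun i => ?_) i <;> simp

theorem isSemilinear_of_definable_preimage_joinQ {m n : ℕ} {D : Set ((Fin m → ℚ) × (Fin n → ℚ))}
    (hD : Set.Definable (Set.univ : Set ℚ) DOAGLang (joinQ m n ⁻¹' D)) : IsSemilinear D := by
  convert hD.isSemilinear.preimage (appendLinearMap m n).toAffineMap using 1
  ext p
  change p ∈ D ↔ joinQ m n (Fin.append p.1 p.2) ∈ D
  rw [joinQ_append]

theorem DOAGEquational.preimage_joinQ_setOf_eq {m n : ℕ} {ι : Type*} [Finite ι]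
    (h : ι → ((Fin m → ℚ) × (Fin n → ℚ) →ᵃ[ℚ] ℚ)) (T : Set ι) :
    DOAGEquational (m + n) (joinQ m n ⁻¹' {p | {i | h i p = 0} = T}) := by
  have key : ∀ i, DOAGEquational (m + n) {v | h i (joinQ m n v) = 0 ↔ i ∈ T} := by
    intro i
    have hi : DOAGEquational (m + n) {v | h i (joinQ m n v) = 0} :=
      setOf_eq_zero ((h i).comp (joinLinearMap m n).toAffineMap)
    by_cases hiT : i ∈ T
    · simpa only [hiT, iff_true] using hi
    · simpa only [hiT, iff_false, Set.compl_ofPred] using hi.compl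
  convert iInter key using 1
  ext v
  simp [Set.ext_iff]

theorem definable_setOf_forall_sign_eq {k : ℕ} {ι : Type*} [Finite ι]
    (u : ι → ((Fin k → ℚ) →ᵃ[ℚ] ℚ)) (σ : ι → SignType) :
    Set.Definable (Set.univ : Set ℚ) DOAGLang {x | (fun j => SignType.sign (u j x)) = σ} := by
  convert Set.definable_iInter_of_finite fun j => definable_setOf_sign_eq (u j) (σ j) using 1
  ext x
  simp [funext_iff]

theorem stmt1 (m n : ℕ) (hm : 1 ≤ m) (hn : 1 ≤ n)
    (D : Set ((Fin m → ℚ) × (Fin n → ℚ)))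
    (hD : Set.Definable (Set.univ : Set ℚ) DOAGLang (joinQ m n ⁻¹' D)) :
    IsStable D ↔
      ∃ (k : ℕ) (Z : Fin k → Set ((Fin m → ℚ) × (Fin n → ℚ)))
        (X : Fin k → Set (Fin m → ℚ)) (Y : Fin k → Set (Fin n → ℚ)),
        (∀ i, DOAGEquational (m + n) (joinQ m n ⁻¹' Z i)) ∧
        (∀ i, Set.Definable (Set.univ : Set ℚ) DOAGLang (X i)) ∧
        (∀ i, Set.Definable (Set.univ : Set ℚ) DOAGLang (Y i)) ∧
        D = ⋃ i, Z i ∩ (X i) ×ˢ (Y i) := by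
  constructor
  · intro hst
    obtain ⟨ι, _, h, hh⟩ := isSemilinear_of_definable_preimage_joinQ hD
    obtain ⟨u, v, huv⟩ := exists_sign_invariant_of_isStable hh hst
    let pat : (Fin m → ℚ) × (Fin n → ℚ) →
        Set ι × (Set ι × ι → SignType) × (Set ι × ι → SignType) := fun p =>
      ({i | h i p = 0}, fun j => SignType.sign (u j p.1), fun j => SignType.sign (v j p.2))
    obtain ⟨k, ⟨e⟩⟩ := Finite.exists_equiv_fin (pat '' D)
    refine ⟨k, fun i => {p | {l | h l p = 0} = (e.symm i).1.1},
      fun i => {x | (fun j => SignType.sign (u j x)) = (e.symm i).1.2.1},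
      fun i => {y | (fun j => SignType.sign (v j y)) = (e.symm i).1.2.2},
      fun i => DOAGEquational.preimage_joinQ_setOf_eq h _,
      fun i => definable_setOf_forall_sign_eq u _,
      fun i => definable_setOf_forall_sign_eq v _, ?_⟩
    ext q
    simp only [Set.mem_iUnion]
    constructor
    · intro hq
      refine ⟨e ⟨pat q, q, hq, rfl⟩, ?_⟩
      rw [e.symm_apply_apply]
      exact ⟨rfl, rfl, rfl⟩
    · rintro ⟨i, hZ, hX, hY⟩
      obtain ⟨p, hp, hpat⟩ := (e.symm i).2
      rw [← hpat] at hZ hX hY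
      exact huv p q (fun l => (Set.ext_iff.1 hZ l).symm) (fun j => (congrFun hX j).symm)
        (fun j => (congrFun hY j).symm) hp
  · rintro ⟨k, Z, X, Y, hZ, -, -, rfl⟩
    refine (LadderFree.iUnion fun i => LadderFree.inter ?_ (LadderFree.prod _ _)).isStable
    simpa [joinQ_append] using (hZ i).ladderFree
end
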